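/- Fix 0 < q < 1, a real number a > 0, integers N ≥ 2 and 1 ≤ n ≤ N-1, and parameters α > -1, -1 < β < 2a. The q-Racah polynomial R_n^{(α,β)}(·;q) has n distinct real zeros X_1(α,β) < ⋯ < X_n(α,β). If a ≥ 1/2, then for each j ∈ {1,...,n} the zero X_j(α,β) is a strictly decreasing function of α on (-1, ∞) and a strictly increasing function of β on (-1, 2a). If 0 < a < 1/2, then for each fixed β ∈ (a - 1/2, 2a) each zero X_j(α,β) is a strictly decreasing function of α on (-1, ∞), and each zero X_j(α,β) is a strictly increasing function of β on (a - 1/2, 2a). -/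

import Mathlib

/-- q-Pochhammer symbol `(a;q)_k = ∏_{j=0}^{k-1} (1 - a q^j)`. -/
noncomputable def qpoch (q a : ℝ) (k : ℕ) : ℝ := ∏ j ∈ Finset.range k, (1 - a * q ^ j)

/-- q-Racah polynomial `R_n^{(α,β)}(X;q)` in the variable `X` of the q-quadratic grid
`X = (q^s + q^{-s})/2`. -/
noncomputable def qRacahPoly (q a : ℝ) (N n : ℕ) (α β X : ℝ) : ℝ :=
  ∑ k ∈ Finset.range (n + 1),
    qpoch q (q ^ (-(n : ℤ))) k * qpoch q (q ^ (α + β + (n : ℝ) + 1)) k *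
      (∏ j ∈ Finset.range k,
        (1 - 2 * q ^ (a + (j : ℝ)) * X + q ^ (2 * (a + (j : ℝ))))) /
      (qpoch q (q ^ (2 * a + α + (N : ℝ))) k * qpoch q (q ^ (β + 1)) k *
        qpoch q (q ^ ((1 : ℝ) - (N : ℝ))) k * qpoch q q k) * q ^ k


open Polynomial in
/-- `p` is orthogonal to all polynomials of degree less than `n` with respect to the discrete
measure with masses `w x` at the points `ξ x`, `x < N`. -/
def DiscreteOrthogonal (ξ w : ℕ → ℝ) (N n : ℕ) (p : ℝ[X]) : Prop :=
  ∀ f : ℝ[X], f.degree < n → ∑ x ∈ Finset.range N, w x * (p * f).eval (ξ x) = 0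

namespace DiscreteOrthogonal

open Polynomial

variable {ξ w : ℕ → ℝ} {N n : ℕ} {p : ℝ[X]}

/-- An orthogonal polynomial of degree `n < N` has no quadratic factor which is nonnegative on
the real line. -/
lemma not_dvd_of_nonneg (hp : DiscreteOrthogonal ξ w N n p) (hξ : Set.InjOn ξ (Finset.range N))
    (hw : ∀ x < N, 0 < w x) (hdeg : p.natDegree = n) (hp0 : p ≠ 0) (hn : n < N) {s : ℝ[X]}
    (hs : s.natDegree = 2) (hs0 : ∀ x, 0 ≤ s.eval x) : ¬ s ∣ p := by
  rintro ⟨d, rfl⟩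
  have hs1 : s ≠ 0 := left_ne_zero_of_mul hp0
  have hd1 : d ≠ 0 := right_ne_zero_of_mul hp0
  rw [natDegree_mul hs1 hd1] at hdeg
  have h := hp d (by rw [degree_eq_natDegree hd1]; exact_mod_cast (by omega))
  rw [Finset.sum_eq_zero_iff_of_nonneg] at h
  · apply hp0
    refine eq_zero_of_degree_lt_of_eval_index_eq_zero (Finset.range N) hξ ?_ fun x hx ↦ ?_
    · rw [degree_eq_natDegree hp0, natDegree_mul hs1 hd1, Finset.card_range]
      exact_mod_cast (by omega)
    · have := h x hx
      have hwx := hw x (Finset.mem_range.1 hx)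
      simp only [eval_mul, mul_eq_zero, hwx.ne', false_or] at this ⊢
      tauto
  · intro x hx
    have hwx := hw x (Finset.mem_range.1 hx)
    have := mul_nonneg hwx.le (mul_nonneg (hs0 (ξ x)) (mul_self_nonneg (d.eval (ξ x))))
    simpa only [eval_mul, mul_assoc] using this

/-- An orthogonal polynomial of degree `n < N` has `n` distinct real zeros. -/
lemma exists_strictMono_zeros (hp : DiscreteOrthogonal ξ w N n p)
    (hξ : Set.InjOn ξ (Finset.range N)) (hw : ∀ x < N, 0 < w x) (hdeg : p.natDegree = n)
    (hp0 : p ≠ 0) (hn : n < N) :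
    ∃ z : Fin n → ℝ, StrictMono z ∧ (∀ j, p.eval (z j) = 0) ∧
      ∀ y, p.eval y = 0 → ∃ j, y = z j := by
  have hsplit : p.Splits := by
    refine (IsAlgClosed.splits _).of_splits_map (algebraMap ℝ ℂ) fun z hz ↦ ?_
    rw [mem_roots (by simpa using hp0), IsRoot, eval_map_algebraMap] at hz
    by_cases him : z.im = 0
    · exact ⟨z.re, Complex.ext (by simp) (by simp [him])⟩
    · refine absurd (p.quadratic_dvd_of_aeval_eq_zero_im_ne_zero hz him)
        (hp.not_dvd_of_nonneg hξ hw hdeg hp0 hn ?_ fun x ↦ ?_)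
      · compute_degree!
      · have hz2 : ‖z‖ ^ 2 = z.re ^ 2 + z.im ^ 2 := by
          rw [← Complex.normSq_eq_norm_sq, Complex.normSq_apply]; ring
        simp only [eval_add, eval_sub, eval_pow, eval_X, eval_mul, eval_C, hz2]
        nlinarith [sq_nonneg (x - z.re), sq_nonneg z.im]
  have hnodup : p.roots.Nodup := by
    rw [Multiset.nodup_iff_count_le_one]
    intro a
    rw [count_roots]
    by_contra! h
    refine hp.not_dvd_of_nonneg hξ hw hdeg hp0 hn (s := (X - C a) ^ 2) ?_ (fun x ↦ ?_)
      ((pow_dvd_pow _ h).trans (pow_rootMultiplicity_dvd p a))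
    · compute_degree!
    · simp only [eval_pow]; positivity
  have hcard : p.roots.toFinset.card = n := by
    rw [Multiset.toFinset_card_of_nodup hnodup, ← hsplit.natDegree_eq_card_roots, hdeg]
  have hmem : ∀ y, y ∈ p.roots.toFinset ↔ p.eval y = 0 := fun y ↦ by simp [hp0]
  refine ⟨p.roots.toFinset.orderEmbOfFin hcard, (p.roots.toFinset.orderEmbOfFin hcard).strictMono,
    fun j ↦ (hmem _).1 (Finset.orderEmbOfFin_mem _ hcard j), fun y hy ↦ ?_⟩
  have : y ∈ Set.range (p.roots.toFinset.orderEmbOfFin hcard) := by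
    rw [Finset.range_orderEmbOfFin]; exact (hmem y).2 hy
  exact this.imp fun _ h ↦ h.symm

/-- Gauss quadrature. -/
lemma sum_eq_sum_basis (hp : DiscreteOrthogonal ξ w N n p) (hdeg : p.natDegree = n) (hp0 : p ≠ 0)
    {z : Fin n → ℝ} (hz : Function.Injective z) (hroot : ∀ j, p.eval (z j) = 0) {f : ℝ[X]}
    (hf : f.natDegree < 2 * n) :
    ∑ x ∈ Finset.range N, w x * f.eval (ξ x) = ∑ j, f.eval (z j) *
      ∑ x ∈ Finset.range N, w x * (Lagrange.basis Finset.univ z j).eval (ξ x) := by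
  have hdegp : p.degree = n := by rw [degree_eq_natDegree hp0, hdeg]
  have hdiv : (f / p).degree < n := by
    rcases lt_or_ge f.degree p.degree with h | h
    · rw [(Polynomial.div_eq_zero_iff hp0).2 h, degree_zero]; exact WithBot.bot_lt_coe _
    · have hf0 : f ≠ 0 := by
        rintro rfl
        simp [hp0] at h
      have h1 := degree_add_div hp0 h
      have hfp : f / p ≠ 0 := by
        rw [Ne, Polynomial.div_eq_zero_iff hp0]; exact h.not_gt
      rw [hdegp, degree_eq_natDegree hf0, degree_eq_natDegree hfp] at h1
      rw [degree_eq_natDegree hfp]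
      norm_cast at h1 ⊢
      omega
  have hfe : f = p * (f / p) + f % p := (EuclideanDomain.div_add_mod f p).symm
  have hev : ∀ j, (f % p).eval (z j) = f.eval (z j) := fun j ↦ by
    conv_rhs => rw [hfe]
    simp [hroot]
  have hr : f % p = Lagrange.interpolate Finset.univ z fun j ↦ f.eval (z j) := by
    refine Lagrange.eq_interpolate_of_eval_eq _ hz.injOn ?_ fun j _ ↦ hev j
    simpa [hdegp] using degree_mod_lt f hp0
  have h0 := hp _ hdiv
  calc ∑ x ∈ Finset.range N, w x * f.eval (ξ x)
      = ∑ x ∈ Finset.range N, (w x * (p * (f / p)).eval (ξ x) + w x * (f % p).eval (ξ x)) := by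
        refine Finset.sum_congr rfl fun x _ ↦ ?_
        rw [← mul_add, ← eval_add, ← hfe]
    _ = ∑ x ∈ Finset.range N, w x * (f % p).eval (ξ x) := by
        rw [Finset.sum_add_distrib, h0, zero_add]
    _ = _ := by
        rw [hr]
        simp only [Lagrange.interpolate_apply, eval_finsetSum, eval_mul, eval_C, Finset.mul_sum]
        rw [Finset.sum_comm]
        refine Finset.sum_congr rfl fun j _ ↦ Finset.sum_congr rfl fun x _ ↦ by ring

/-- A polynomial of degree less than `2n` which is nonnegative at the zeros of the orthogonal
polynomial of degree `n` has a nonnegative sum. -/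
lemma sum_nonneg (hp : DiscreteOrthogonal ξ w N n p) (hw : ∀ x < N, 0 < w x)
    (hdeg : p.natDegree = n) (hp0 : p ≠ 0) {z : Fin n → ℝ} (hz : Function.Injective z)
    (hroot : ∀ j, p.eval (z j) = 0) {f : ℝ[X]} (hf : f.natDegree < 2 * n)
    (hfz : ∀ j, 0 ≤ f.eval (z j)) : 0 ≤ ∑ x ∈ Finset.range N, w x * f.eval (ξ x) := by
  rw [hp.sum_eq_sum_basis hdeg hp0 hz hroot hf]
  refine Finset.sum_nonneg fun j _ ↦ mul_nonneg (hfz j) ?_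
  have hn := j.pos
  have hb : (Lagrange.basis Finset.univ z j ^ 2).natDegree < 2 * n := by
    rw [natDegree_pow, Lagrange.natDegree_basis hz.injOn (Finset.mem_univ j), Finset.card_univ,
      Fintype.card_fin]
    omega
  have h := hp.sum_eq_sum_basis hdeg hp0 hz hroot hb
  rw [Finset.sum_eq_single_of_mem j (Finset.mem_univ j), eval_pow,
    Lagrange.eval_basis_self hz.injOn (Finset.mem_univ j), one_pow, one_mul] at h
  · rw [← h]
    refine Finset.sum_nonneg fun x hx ↦ mul_nonneg (hw x (Finset.mem_range.1 hx)).le ?_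
    rw [eval_pow]
    positivity
  · intro i _ hij
    rw [eval_pow, Lagrange.eval_basis_of_ne hij.symm (Finset.mem_univ i)]
    simp

/-- Markov's theorem on the monotonicity of zeros: if the ratio `w₂ / w₁` of two weights is
strictly increasing, then the zeros of the orthogonal polynomials for `w₂` are strictly larger. -/
lemma zeros_lt_zeros {w₁ w₂ : ℕ → ℝ} {p₁ p₂ : ℝ[X]} (hp₁ : DiscreteOrthogonal ξ w₁ N n p₁)
    (hp₂ : DiscreteOrthogonal ξ w₂ N n p₂) (hξ : StrictMono ξ) (hn : n < N)
    (hw₁ : ∀ x < N, 0 < w₁ x) (hw₂ : ∀ x < N, 0 < w₂ x)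
    (hw : ∀ x y, x < y → y < N → w₂ x * w₁ y < w₂ y * w₁ x)
    (hdeg₁ : p₁.natDegree = n) (hdeg₂ : p₂.natDegree = n) (h₁0 : p₁ ≠ 0) (h₂0 : p₂ ≠ 0)
    {z₁ z₂ : Fin n → ℝ} (hz₁ : StrictMono z₁) (hz₂ : StrictMono z₂)
    (hroot₁ : ∀ j, p₁.eval (z₁ j) = 0) (hroot₂ : ∀ j, p₂.eval (z₂ j) = 0) (j : Fin n) :
    z₁ j < z₂ j := by
  by_contra! hle
  set g : ℝ[X] := (∏ i ∈ Finset.Iio j, (X - C (z₁ i))) * ∏ i ∈ Finset.Ioi j, (X - C (z₂ i))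
    with hg
  have hjn := j.isLt
  have hgm : g.Monic := (monic_prod_of_monic _ _ fun i _ ↦ monic_X_sub_C _).mul
    (monic_prod_of_monic _ _ fun i _ ↦ monic_X_sub_C _)
  have hgdeg : g.natDegree = n - 1 := by
    rw [hg, Monic.natDegree_mul (monic_prod_of_monic _ _ fun i _ ↦ monic_X_sub_C _)
      (monic_prod_of_monic _ _ fun i _ ↦ monic_X_sub_C _)]
    rw [natDegree_prod_of_monic _ _ fun i _ ↦ monic_X_sub_C _,
      natDegree_prod_of_monic _ _ fun i _ ↦ monic_X_sub_C _]
    simp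
    omega
  have hg1 : ∀ i < j, g.eval (z₁ i) = 0 := fun i hi ↦ by
    rw [hg, eval_mul, eval_prod, Finset.prod_eq_zero (Finset.mem_Iio.2 hi) (by simp), zero_mul]
  have hg2 : ∀ i, j < i → g.eval (z₂ i) = 0 := fun i hi ↦ by
    rw [hg, eval_mul, eval_prod, eval_prod,
      Finset.prod_eq_zero (Finset.mem_Ioi.2 hi) (by simp), mul_zero]
  have hfdeg : ∀ t : ℝ, ((X - C t) * g ^ 2).natDegree < 2 * n := fun t ↦ by
    rw [(monic_X_sub_C t).natDegree_mul (hgm.pow 2), natDegree_X_sub_C, hgm.natDegree_pow, hgdeg]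
    omega
  have hQ₁ := hp₁.sum_nonneg hw₁ hdeg₁ h₁0 hz₁.injective hroot₁ (hfdeg (z₁ j)) fun i ↦ by
    rw [eval_mul, eval_pow]
    rcases lt_or_ge i j with h | h
    · simp [hg1 i h]
    · have := hz₁.monotone h
      have : 0 ≤ (X - C (z₁ j)).eval (z₁ i) := by simpa
      positivity
  have hQ₂ := hp₂.sum_nonneg hw₂ hdeg₂ h₂0 hz₂.injective hroot₂
    (f := -((X - C (z₂ j)) * g ^ 2)) (by rw [natDegree_neg]; exact hfdeg _) fun i ↦ by
    rw [eval_neg, eval_mul, eval_pow]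
    rcases lt_or_ge j i with h | h
    · simp [hg2 i h]
    · have := hz₂.monotone h
      have : (X - C (z₂ j)).eval (z₂ i) ≤ 0 := by simpa
      nlinarith [sq_nonneg (g.eval (z₂ i))]
  have hQ₂' : ∑ x ∈ Finset.range N, w₂ x * ((X - C (z₁ j)) * g ^ 2).eval (ξ x) ≤ 0 := by
    simp only [eval_neg, mul_neg, Finset.sum_neg_distrib] at hQ₂
    refine le_trans (Finset.sum_le_sum fun x hx ↦ ?_) (neg_nonneg.1 hQ₂)
    have := hw₂ x (Finset.mem_range.1 hx)
    simp only [eval_mul, eval_sub, eval_X, eval_C, eval_pow]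
    gcongr
  set m := Nat.findGreatest (fun x ↦ ξ x ≤ z₁ j) (N - 1) with hm
  have hmN : m < N := by have := Nat.findGreatest_le (P := fun x ↦ ξ x ≤ z₁ j) (N - 1); omega
  have hsign : ∀ x < N, x ≠ m → 0 < (w₂ x * w₁ m - w₂ m * w₁ x) * (ξ x - z₁ j) := by
    intro x hx hxm
    rcases lt_or_gt_of_ne hxm with h | h
    · have h1 : ξ m ≤ z₁ j := Nat.findGreatest_of_ne_zero (P := fun x ↦ ξ x ≤ z₁ j) hm.symm (by omega)
      have h2 := hξ h
      have h3 := hw x m h hmN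
      exact mul_pos_of_neg_of_neg (by linarith) (by linarith)
    · have h1 := Nat.findGreatest_is_greatest h (by omega)
      have h3 := hw m x h hx
      exact mul_pos (by linarith) (by linarith)
  have hnn : ∀ x ∈ Finset.range N,
      0 ≤ (w₂ x * w₁ m - w₂ m * w₁ x) * (ξ x - z₁ j) * g.eval (ξ x) ^ 2 := by
    intro x hx
    by_cases hxm : x = m
    · simp [hxm]
    · exact mul_nonneg (hsign x (Finset.mem_range.1 hx) hxm).le (sq_nonneg _)
  have hle0 : ∑ x ∈ Finset.range N,
      (w₂ x * w₁ m - w₂ m * w₁ x) * (ξ x - z₁ j) * g.eval (ξ x) ^ 2 ≤ 0 := by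
    have : ∑ x ∈ Finset.range N, (w₂ x * w₁ m - w₂ m * w₁ x) * (ξ x - z₁ j) * g.eval (ξ x) ^ 2 =
        w₁ m * (∑ x ∈ Finset.range N, w₂ x * ((X - C (z₁ j)) * g ^ 2).eval (ξ x)) -
        w₂ m * (∑ x ∈ Finset.range N, w₁ x * ((X - C (z₁ j)) * g ^ 2).eval (ξ x)) := by
      rw [Finset.mul_sum, Finset.mul_sum, ← Finset.sum_sub_distrib]
      refine Finset.sum_congr rfl fun x _ ↦ ?_
      simp only [eval_mul, eval_sub, eval_X, eval_C, eval_pow]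
      ring
    rw [this]
    nlinarith [hw₁ m hmN, hw₂ m hmN]
  have hzero := (Finset.sum_eq_zero_iff_of_nonneg hnn).1 (le_antisymm hle0 (Finset.sum_nonneg hnn))
  refine hgm.ne_zero (eq_zero_of_degree_lt_of_eval_index_eq_zero
    ((Finset.range N).erase m) hξ.injective.injOn ?_ fun x hx ↦ ?_)
  · rw [degree_eq_natDegree hgm.ne_zero, hgdeg,
      Finset.card_erase_of_mem (Finset.mem_range.2 hmN), Finset.card_range]
    exact_mod_cast (by omega)
  · obtain ⟨hxm, hx⟩ := Finset.mem_erase.1 hx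
    have := hzero x hx
    simpa [(hsign x (Finset.mem_range.1 hx) hxm).ne'] using this

end DiscreteOrthogonal

/-! ### The difference equation of the `q`-Racah polynomials -/

open Polynomial in
/-- The basis `∏_{j<k} (1 - 2 e q^j X + e² q^{2j})` of the polynomials, where `e = q^a`. -/
noncomputable def racahBasis (q e : ℝ) (k : ℕ) : ℝ[X] :=
  ∏ j ∈ Finset.range k, (C (-(2 * (e * q ^ j))) * X + C (1 + (e * q ^ j) ^ 2))

/-- The values of `racahBasis` on the grid, in terms of `u = q^x` and `E = q^{2a}`. -/
noncomputable def racahBasisVal (q E u : ℝ) (k : ℕ) : ℝ :=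
  ∏ j ∈ Finset.range k, ((1 - E * q ^ j * u) * (1 - q ^ j / u))

/-- The points of the grid. -/
noncomputable def racahGrid (q e : ℝ) (x : ℕ) : ℝ := (e * q ^ x + (e * q ^ x)⁻¹) / 2

/-- The forward coefficient of the `q`-Racah difference operator at `u = q^x`, in terms of
`A = q^β`, `B = q^α`, `E = q^{2a}` and `M = q^N`. -/
noncomputable def racahFwd (q A B E M u : ℝ) : ℝ :=
  (1 - A * q * u) * (1 - B * E * M * u) * (1 - u * q / M) * (1 - E * u) /
    ((1 - E * u ^ 2) * (1 - E * q * u ^ 2))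

/-- The backward coefficient of the `q`-Racah difference operator at `u = q^x`. -/
noncomputable def racahBwd (q A B E M u : ℝ) : ℝ :=
  q * (1 - u) * (1 - E * M * u / q) * (B - u / M) * (A - E * u / q) /
    ((1 - E * u ^ 2 / q) * (1 - E * u ^ 2))

/-- The `q`-Racah weight. -/
noncomputable def racahWeight (q A B E M : ℝ) (x : ℕ) : ℝ :=
  ∏ i ∈ Finset.range x, (racahFwd q A B E M (q ^ i) / racahBwd q A B E M (q ^ (i + 1)))

/-- The eigenvalues of the `q`-Racah difference operator. -/
noncomputable def racahEigenvalue (q A B : ℝ) (k : ℕ) : ℝ :=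
  ((q ^ k)⁻¹ - 1) * (1 - A * B * q ^ (k + 1))

/-- The coefficients of the `q`-Racah polynomials with respect to `racahBasis`. -/
noncomputable def racahCoeff (q A B E M : ℝ) (n k : ℕ) : ℝ :=
  qpoch q (q ^ n)⁻¹ k * qpoch q (A * B * q ^ (n + 1)) k * q ^ k /
    (qpoch q (B * E * M) k * qpoch q (A * q) k * qpoch q (q / M) k * qpoch q q k)

lemma qpoch_succ (q a : ℝ) (k : ℕ) : qpoch q a (k + 1) = qpoch q a k * (1 - a * q ^ k) :=
  Finset.prod_range_succ _ _

lemma qpoch_ne_zero {q a : ℝ} {k : ℕ} (h : ∀ j < k, a * q ^ j ≠ 1) : qpoch q a k ≠ 0 :=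
  Finset.prod_ne_zero_iff.2 fun j hj ↦ sub_ne_zero.2 (h j (Finset.mem_range.1 hj)).symm

lemma racahBasisVal_succ (q E u : ℝ) (k : ℕ) : racahBasisVal q E u (k + 1) =
    racahBasisVal q E u k * ((1 - E * q ^ k * u) * (1 - q ^ k / u)) :=
  Finset.prod_range_succ _ _

lemma eval_racahBasis {q e : ℝ} (hq : q ≠ 0) (he : e ≠ 0) (k x : ℕ) :
    (racahBasis q e k).eval (racahGrid q e x) = racahBasisVal q (e ^ 2) (q ^ x) k := by
  rw [racahBasis, racahBasisVal, Polynomial.eval_prod]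
  refine Finset.prod_congr rfl fun j _ ↦ ?_
  have := pow_ne_zero x hq
  simp only [racahGrid, Polynomial.eval_add, Polynomial.eval_mul, Polynomial.eval_C,
    Polynomial.eval_X]
  field_simp
  ring

lemma degree_racahBasis {q e : ℝ} (hq : q ≠ 0) (he : e ≠ 0) (k : ℕ) :
    (racahBasis q e k).degree = k := by
  rw [racahBasis, Polynomial.degree_prod, Finset.sum_congr rfl fun j _ ↦
    Polynomial.degree_linear (neg_ne_zero.2
      (mul_ne_zero two_ne_zero (mul_ne_zero he (pow_ne_zero j hq))))]
  simp

lemma strictMono_racahGrid {q e : ℝ} (hq0 : 0 < q) (hq1 : q < 1) (he0 : 0 < e) (he1 : e < 1) :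
    StrictMono (racahGrid q e) := by
  refine strictMono_nat_of_lt_succ fun x ↦ ?_
  have hu : 0 < q ^ x := pow_pos hq0 x
  have hu1 : q ^ x ≤ 1 := pow_le_one₀ hq0.le hq1.le
  have h1 : e * q ^ x < 1 := by nlinarith
  have h2 : racahGrid q e (x + 1) - racahGrid q e x =
      (1 - q) * (1 - q * (e * q ^ x) ^ 2) / (2 * (q * (e * q ^ x))) := by
    simp only [racahGrid, pow_succ]
    field_simp
    ring
  have h3 : 0 < 1 - q * (e * q ^ x) ^ 2 := by
    have : (e * q ^ x) ^ 2 < 1 := pow_lt_one₀ (by positivity) h1 two_ne_zero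
    nlinarith [sq_nonneg (e * q ^ x)]
  have h4 : 0 < 1 - q := by linarith
  rw [← sub_pos, h2]
  positivity

lemma racahBasisVal_forward {q u : ℝ} (hq : q ≠ 0) (hu : u ≠ 0) (E : ℝ) (k : ℕ) :
    (1 - E * u) * racahBasisVal q E (u * q) (k + 1) = racahBasisVal q E u k *
      ((1 - 1 / (q * u)) * (1 - E * q ^ k * u) * (1 - E * q ^ k * q * u)) := by
  induction k with
  | zero => simp [racahBasisVal]; ring
  | succ k ih =>
    rw [racahBasisVal_succ, ← mul_assoc, ih, racahBasisVal_succ]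
    field_simp
    ring

lemma racahBasisVal_backward {q u : ℝ} (hq : q ≠ 0) (hu : u ≠ 0) (E : ℝ) (k : ℕ) :
    (1 - 1 / (u * q)) * racahBasisVal q E u (k + 1) = racahBasisVal q E (u * q) k *
      ((1 - q ^ k / (u * q)) * (1 - q ^ k * q / (u * q)) * (1 - E * u)) := by
  induction k with
  | zero => simp [racahBasisVal]; field_simp
  | succ k ih =>
    rw [racahBasisVal_succ, ← mul_assoc, ih, racahBasisVal_succ]
    field_simp
    ring

lemma racahBasisVal_one (q E : ℝ) (k : ℕ) : racahBasisVal q E 1 (k + 1) = 0 :=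
  Finset.prod_eq_zero (Finset.mem_range.2 k.succ_pos) (by simp)

lemma racah_triangular_aux {q A B E M K u y₀ y y₁ y₂ : ℝ} (hq : q ≠ 0) (hM : M ≠ 0) (hK : K ≠ 0)
    (hu : u ≠ 0) (h0 : 1 - u ≠ 0) (h2 : 1 - E * u ^ 2 ≠ 0)
    (h3 : 1 - E * q * u ^ 2 ≠ 0) (h4 : q - E * u ^ 2 ≠ 0)
    (hy : y = y₀ * ((1 - E * K * u) * (1 - K / u)))
    (hy₁ : (1 - E * u) * y₁ = y₀ * ((1 - 1 / (q * u)) * (1 - E * K * u) * (1 - E * K * q * u)))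
    (hy₂ : (1 - 1 / u) * y₂ = y₀ * ((1 - K / u) * (1 - K * q / u) * (1 - E * u / q))) :
    racahFwd q A B E M u * (y₁ - y) + racahBwd q A B E M u * (y₂ - y) =
      ((K * q)⁻¹ - 1) * (1 - A * B * (K * q * q)) * y +
      -(K * q)⁻¹ * (1 - A * q * K) * (1 - B * E * M * K) * (1 - q / M * K) * (1 - q * K) * y₀ := by
  have h1' : 1 - 1 / u ≠ 0 := by
    rw [one_sub_div hu]
    exact div_ne_zero (fun h ↦ h0 (by linarith)) hu
  have h4' : 1 - E * u ^ 2 / q ≠ 0 := by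
    rw [one_sub_div hq]
    exact div_ne_zero h4 hq
  have e1 : racahFwd q A B E M u * (y₁ - y) = y₀ * (1 - E * K * u) *
      ((1 - A * q * u) * (1 - B * E * M * u) * (1 - u * q / M) *
      ((1 - 1 / (q * u)) * (1 - E * K * q * u) - (1 - E * u) * (1 - K / u)) /
      ((1 - E * u ^ 2) * (1 - E * q * u ^ 2))) := by
    have : (1 - E * u) * (y₁ - y) = y₀ * (1 - E * K * u) *
      ((1 - 1 / (q * u)) * (1 - E * K * q * u) - (1 - E * u) * (1 - K / u)) := by
      rw [mul_sub, hy₁, hy]; ring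
    rw [racahFwd]
    linear_combination ((1 - A * q * u) * (1 - B * E * M * u) * (1 - u * q / M) /
      ((1 - E * u ^ 2) * (1 - E * q * u ^ 2))) * this
  have e2 : racahBwd q A B E M u * (y₂ - y) = y₀ * (1 - K / u) *
      (-u * q * (1 - E * M * u / q) * (B - u / M) * (A - E * u / q) *
      ((1 - K * q / u) * (1 - E * u / q) - (1 - 1 / u) * (1 - E * K * u)) /
      ((1 - E * u ^ 2 / q) * (1 - E * u ^ 2))) := by
    have : (1 - 1 / u) * (y₂ - y) = y₀ * (1 - K / u) *
      ((1 - K * q / u) * (1 - E * u / q) - (1 - 1 / u) * (1 - E * K * u)) := by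
      rw [mul_sub, hy₂, hy]; ring
    have h' : (1 - u) = - u * (1 - 1 / u) := by field_simp; ring
    rw [racahBwd, h']
    linear_combination (- u * q * (1 - E * M * u / q) * (B - u / M) * (A - E * u / q) /
      ((1 - E * u ^ 2 / q) * (1 - E * u ^ 2))) * this
  have s1 : (1 - 1 / (q * u)) * (1 - E * K * q * u) - (1 - E * u) * (1 - K / u) =
      (K * q - 1) * (1 - E * q * u ^ 2) / (q * u) := by
    field_simp
    ring
  have s2 : (1 - K * q / u) * (1 - E * u / q) - (1 - 1 / u) * (1 - E * K * u) =
      (1 - K * q) * (1 - E * u ^ 2 / q) / u := by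
    field_simp
    ring
  have cancel : ∀ a b c d t : ℝ, t ≠ 0 → a * (b * t / c) / (d * t) = a * b / (c * d) := by
    intro a b c d t ht
    rw [← mul_div_assoc, div_div, ← mul_assoc, ← mul_assoc, mul_div_mul_right _ _ ht]
  have e3 : racahFwd q A B E M u * (y₁ - y) = y₀ * (1 - E * K * u) *
      ((1 - A * q * u) * (1 - B * E * M * u) * (1 - u * q / M) * (K * q - 1) /
      (q * u * (1 - E * u ^ 2))) := by
    rw [e1, s1, cancel _ _ _ _ _ h3]
  have e4 : racahBwd q A B E M u * (y₂ - y) = y₀ * (1 - K / u) *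
      (-u * q * (1 - E * M * u / q) * (B - u / M) * (A - E * u / q) * (1 - K * q) /
      (u * (1 - E * u ^ 2))) := by
    rw [e2, s2, mul_comm (1 - E * u ^ 2 / q) (1 - E * u ^ 2), cancel _ _ _ _ _ h4']
  rw [e3, e4, hy]
  field_simp
  ring

/-- The difference operator is triangular with respect to `racahBasis`. -/
lemma racah_triangular {q A B E M : ℝ} (hq0 : 0 < q) (hq1 : q < 1) (hE0 : 0 < E) (hE1 : E < 1)
    (hM : M ≠ 0) (k x : ℕ) :
    racahFwd q A B E M (q ^ x) *
        (racahBasisVal q E (q ^ (x + 1)) (k + 1) - racahBasisVal q E (q ^ x) (k + 1)) +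
      racahBwd q A B E M (q ^ x) *
        (racahBasisVal q E (q ^ (x - 1)) (k + 1) - racahBasisVal q E (q ^ x) (k + 1)) =
      racahEigenvalue q A B (k + 1) * racahBasisVal q E (q ^ x) (k + 1) +
      -(q ^ (k + 1))⁻¹ * (1 - A * q * q ^ k) * (1 - B * E * M * q ^ k) * (1 - q / M * q ^ k) *
        (1 - q * q ^ k) * racahBasisVal q E (q ^ x) k := by
  have hq := hq0.ne'
  have hK : q ^ k ≠ 0 := pow_ne_zero k hq
  have hEq : E * q < 1 := by nlinarith
  rcases x with _ | x
  · have hEq1 : 1 - E * q ≠ 0 := by linarith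
    have hE1' : 1 - E ≠ 0 := by linarith
    simp only [pow_zero, zero_add, pow_one, racahBasisVal_one, racahFwd, Nat.zero_sub]
    rcases k with _ | k
    · have hEq2 : 1 - q * E ≠ 0 := by rwa [mul_comm]
      simp only [racahBasisVal, zero_add, Finset.prod_range_one, Finset.prod_range_zero, pow_zero,
        mul_one, one_pow, pow_one]
      rw [mul_comm E q]
      field_simp
      ring
    · have hf := racahBasisVal_forward hq (one_ne_zero (α := ℝ)) E (k + 1)
      rw [one_mul, racahBasisVal_one] at hf
      rw [racahBasisVal_one]
      have : racahBasisVal q E q (k + 1 + 1) = 0 := by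
        simpa [hE1'] using hf
      simp [this]
  · have hx : q ^ (x + 1) < 1 := pow_lt_one₀ hq0.le hq1 x.succ_ne_zero
    have hx0 : 0 < q ^ x := pow_pos hq0 x
    have hx1 : q ^ x ≤ 1 := pow_le_one₀ hq0.le hq1.le
    have hu0 : 0 < q ^ (x + 1) := pow_pos hq0 _
    have hf := racahBasisVal_forward hq hu0.ne' E k
    have hb := racahBasisVal_backward hq hx0.ne' E k
    have hu2 : (q ^ (x + 1)) ^ 2 < 1 := pow_lt_one₀ hu0.le hx two_ne_zero
    rw [← pow_succ] at hf hb
    have h4 : E * (q ^ (x + 1)) ^ 2 < q := by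
      have : (q ^ (x + 1)) ^ 2 = q * (q * (q ^ x) ^ 2) := by ring
      have h5 : q * (q ^ x) ^ 2 < 1 := by nlinarith [pow_le_one₀ hx0.le hx1 (n := 2)]
      rw [this]
      have : E * (q * (q ^ x) ^ 2) < 1 := by nlinarith
      nlinarith
    have h := racah_triangular_aux (A := A) (B := B) (E := E) hq hM hK hu0.ne'
      (by linarith) (by nlinarith) (by nlinarith) (by linarith)
      (racahBasisVal_succ q E (q ^ (x + 1)) k) hf (y₂ := racahBasisVal q E (q ^ x) (k + 1)) ?_
    · simp only [Nat.add_sub_cancel]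
      rw [h, racahEigenvalue]
      ring
    · rw [hb, pow_succ q x]
      field_simp

/-- The conditions on `q`, `A = q^β`, `B = q^α` and `E = q^{2a}`. -/
structure RacahParams (q A B E : ℝ) : Prop where
  q_pos : 0 < q
  q_lt_one : q < 1
  E_pos : 0 < E
  E_lt_one : E < 1
  E_lt_A : E < A
  A_mul_q : A * q < 1
  B_pos : 0 < B
  B_mul_q : B * q < 1

namespace RacahParams

variable {q A B E : ℝ} {N n : ℕ}

lemma ratio_eq (h : RacahParams q A B E) {x : ℕ} (hx : x + 1 < N) :
    racahFwd q A B E (q ^ N) (q ^ x) / racahBwd q A B E (q ^ N) (q ^ (x + 1)) =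
      (1 - A * q * q ^ x) / (A - E * q ^ x) *
      ((1 - B * E * q ^ N * q ^ x) / (q ^ x * q / q ^ N - B)) *
      ((q ^ x * q / q ^ N - 1) * (1 - E * q ^ x) * (1 - E * q ^ 2 * (q ^ x) ^ 2) /
        (q * (1 - q ^ x * q) * (1 - E * q ^ N * q ^ x) * (1 - E * (q ^ x) ^ 2))) ∧
    0 < q * (1 - q ^ x * q) ∧
    racahBwd q A B E (q ^ N) (q ^ (x + 1)) ≠ 0 ∧
    0 < 1 - A * q * q ^ x ∧ 0 < A - E * q ^ x ∧
    0 < 1 - B * E * q ^ N * q ^ x ∧ 0 < q ^ x * q / q ^ N - B ∧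
    0 < (q ^ x * q / q ^ N - 1) * (1 - E * q ^ x) * (1 - E * q ^ 2 * (q ^ x) ^ 2) /
        (q * (1 - q ^ x * q) * (1 - E * q ^ N * q ^ x) * (1 - E * (q ^ x) ^ 2)) ∧
    0 < 1 - E * q * (q ^ x) ^ 2 := by
  obtain ⟨hq0, hq1, hE0, hE1, hEA, hAq, hB0, hBq⟩ := h
  have hA0 : 0 < A := hE0.trans hEA
  have hM0 : 0 < q ^ N := pow_pos hq0 N
  have hM : q ^ N ≤ q ^ x * q * q := by
    rw [← pow_succ, ← pow_succ]
    exact pow_le_pow_of_le_one hq0.le hq1.le hx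
  have hMq : q ^ N ≤ q := by
    simpa using pow_le_pow_of_le_one hq0.le hq1.le (show 1 ≤ N by omega)
  have hu0 : 0 < q ^ x := pow_pos hq0 x
  have hu1 : q ^ x ≤ 1 := pow_le_one₀ hq0.le hq1.le
  rw [pow_succ q x]
  generalize hu : q ^ x = u at *
  generalize hMM : q ^ N = M at *
  have huq : u * q < 1 := by nlinarith
  have hu2 : u ^ 2 ≤ 1 := pow_le_one₀ hu0.le hu1
  have hv : 1 / q ≤ u * q / M := by
    rw [div_le_div_iff₀ hq0 hM0]; linarith
  have hq1' : 1 < 1 / q := by rw [lt_div_iff₀ hq0]; linarith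
  have hB1 : B < 1 / q := by rw [lt_div_iff₀ hq0]; linarith
  have p1 : 0 < 1 - A * q * u := by nlinarith [mul_pos hA0 hq0]
  have p2 : 0 < A - E * u := by nlinarith
  have hBM : B * M < 1 := by nlinarith
  have hEu : E * u < 1 := by nlinarith
  have p3 : 0 < 1 - B * E * M * u := by
    have : B * E * M * u = (B * M) * (E * u) := by ring
    rw [this]
    nlinarith [mul_pos hB0 hM0, mul_pos hE0 hu0]
  have p4 : 0 < u * q / M - B := by linarith
  have p5 : 0 < u * q / M - 1 := by linarith
  have p6 : 0 < 1 - E * u := by linarith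
  have p7 : 0 < 1 - E * u ^ 2 := by nlinarith
  have p8 : 0 < 1 - E * q * u ^ 2 := by nlinarith
  have p9 : 0 < 1 - E * q ^ 2 * u ^ 2 := by nlinarith
  have p10 : 0 < 1 - E * M * u := by
    have : E * M * u = M * (E * u) := by ring
    rw [this]
    nlinarith [mul_pos hE0 hu0]
  have p11 : 0 < 1 - u * q := by linarith
  have p12 : 0 < q * (1 - u * q) := by positivity
  have hBwd : racahBwd q A B E M (u * q) = - (q * (1 - u * q) * (1 - E * M * u) *
      (u * q / M - B) * (A - E * u) / ((1 - E * q * u ^ 2) * (1 - E * q ^ 2 * u ^ 2))) := by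
    rw [racahBwd, show E * M * (u * q) / q = E * M * u by field_simp,
      show E * (u * q) / q = E * u by field_simp,
      show E * (u * q) ^ 2 / q = E * q * u ^ 2 by field_simp,
      show E * (u * q) ^ 2 = E * q ^ 2 * u ^ 2 by ring]
    ring
  refine ⟨?_, p12, ?_, p1, p2, p3, p4, by positivity, p8⟩
  · rw [hBwd, racahFwd, show 1 - u * q / M = - (u * q / M - 1) by ring]
    generalize 1 - A * q * u = a1 at *
    generalize A - E * u = a2 at *
    generalize 1 - B * E * M * u = a3 at *
    generalize u * q / M - B = a4 at *
    generalize u * q / M - 1 = a5 at *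
    generalize 1 - E * u = a6 at *
    generalize 1 - E * u ^ 2 = a7 at *
    generalize 1 - E * q * u ^ 2 = a8 at *
    generalize 1 - E * q ^ 2 * u ^ 2 = a9 at *
    generalize 1 - E * M * u = a10 at *
    generalize 1 - u * q = a11 at *
    field_simp
  · rw [hBwd]
    exact neg_ne_zero.2 (by positivity)

lemma racahWeight_pos (h : RacahParams q A B E) {x : ℕ} (hx : x < N) :
    0 < racahWeight q A B E (q ^ N) x := by
  refine Finset.prod_pos fun i hi ↦ ?_
  obtain ⟨h0, -, -, h1, h2, h3, h4, h5, -⟩ :=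
    h.ratio_eq (N := N) (x := i) (by have := Finset.mem_range.1 hi; omega)
  rw [h0]
  positivity

lemma racahWeight_balance (h : RacahParams q A B E) {x : ℕ} (hx : x + 1 < N) :
    racahWeight q A B E (q ^ N) x * racahFwd q A B E (q ^ N) (q ^ x) =
      racahWeight q A B E (q ^ N) (x + 1) * racahBwd q A B E (q ^ N) (q ^ (x + 1)) := by
  obtain ⟨-, -, h0, -⟩ := h.ratio_eq hx
  rw [racahWeight, racahWeight, Finset.prod_range_succ, mul_assoc, div_mul_cancel₀ _ h0]

lemma racahWeight_cross {A' B' : ℝ} (h : RacahParams q A B E) (h' : RacahParams q A' B' E)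
    (hr : ∀ x, x + 1 < N →
      racahFwd q A B E (q ^ N) (q ^ x) / racahBwd q A B E (q ^ N) (q ^ (x + 1)) <
      racahFwd q A' B' E (q ^ N) (q ^ x) / racahBwd q A' B' E (q ^ N) (q ^ (x + 1)))
    (x y : ℕ) (hxy : x < y) (hy : y < N) :
    racahWeight q A' B' E (q ^ N) x * racahWeight q A B E (q ^ N) y <
      racahWeight q A' B' E (q ^ N) y * racahWeight q A B E (q ^ N) x := by
  have hstep : ∀ y, y + 1 < N →
      racahWeight q A' B' E (q ^ N) x * racahWeight q A B E (q ^ N) y ≤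
      racahWeight q A' B' E (q ^ N) y * racahWeight q A B E (q ^ N) x →
      racahWeight q A' B' E (q ^ N) x * racahWeight q A B E (q ^ N) (y + 1) <
      racahWeight q A' B' E (q ^ N) (y + 1) * racahWeight q A B E (q ^ N) x := by
    intro y hy hle
    have h1 := h'.racahWeight_pos (N := N) (x := y) (by omega)
    have h2 := h.racahWeight_pos (N := N) (x := y) (by omega)
    by_cases hxN : x < N
    · have h3 := h'.racahWeight_pos hxN
      have h4 := h.racahWeight_pos hxN
      have e : ∀ A B, racahWeight q A B E (q ^ N) (y + 1) = racahWeight q A B E (q ^ N) y *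
        (racahFwd q A B E (q ^ N) (q ^ y) / racahBwd q A B E (q ^ N) (q ^ (y + 1))) :=
        fun A B ↦ Finset.prod_range_succ _ _
      have hr1 := hr y hy
      have h5 : 0 < racahFwd q A' B' E (q ^ N) (q ^ y) /
          racahBwd q A' B' E (q ^ N) (q ^ (y + 1)) := by
        obtain ⟨h0, -, -, h1, h2, h3, h4, h5, -⟩ := h'.ratio_eq hy
        rw [h0]
        positivity
      rw [e, e]
      calc _ = (racahWeight q A' B' E (q ^ N) x * racahWeight q A B E (q ^ N) y) *
            (racahFwd q A B E (q ^ N) (q ^ y) / racahBwd q A B E (q ^ N) (q ^ (y + 1))) := by ring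
        _ < (racahWeight q A' B' E (q ^ N) x * racahWeight q A B E (q ^ N) y) *
            (racahFwd q A' B' E (q ^ N) (q ^ y) / racahBwd q A' B' E (q ^ N) (q ^ (y + 1))) := by
          gcongr
        _ ≤ (racahWeight q A' B' E (q ^ N) y * racahWeight q A B E (q ^ N) x) *
            (racahFwd q A' B' E (q ^ N) (q ^ y) / racahBwd q A' B' E (q ^ N) (q ^ (y + 1))) := by
          gcongr
        _ = _ := by ring
    · omega
  induction y, hxy using Nat.le_induction with
  | base => exact hstep x hy le_rfl
  | succ y _ ih => exact hstep y hy (ih (by omega)).le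

lemma ratio_lt_of_B_lt {B' : ℝ} (h : RacahParams q A B E) (h' : RacahParams q A B' E)
    (hB : B < B') {x : ℕ} (hx : x + 1 < N) :
    racahFwd q A B E (q ^ N) (q ^ x) / racahBwd q A B E (q ^ N) (q ^ (x + 1)) <
      racahFwd q A B' E (q ^ N) (q ^ x) / racahBwd q A B' E (q ^ N) (q ^ (x + 1)) := by
  obtain ⟨h0, -, -, h1, h2, h3, h4, h5, h6⟩ := h.ratio_eq hx
  obtain ⟨h0', -, -, -, -, h3', h4', -, -⟩ := h'.ratio_eq hx
  rw [h0, h0']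
  have hM : q ^ N ≠ 0 := (pow_pos h.q_pos N).ne'
  have key : (1 - B * E * q ^ N * q ^ x) / (q ^ x * q / q ^ N - B) <
      (1 - B' * E * q ^ N * q ^ x) / (q ^ x * q / q ^ N - B') := by
    rw [div_lt_div_iff₀ h4 h4', ← sub_pos]
    have : (1 - B' * E * q ^ N * q ^ x) * (q ^ x * q / q ^ N - B) -
        (1 - B * E * q ^ N * q ^ x) * (q ^ x * q / q ^ N - B') =
        (B' - B) * (1 - E * q * (q ^ x) ^ 2) := by
      field_simp
      ring
    rw [this]
    exact mul_pos (sub_pos.2 hB) h6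
  gcongr

lemma ratio_lt_of_A_lt {A' : ℝ} (h : RacahParams q A B E) (h' : RacahParams q A' B E)
    (hA : A' < A) {x : ℕ} (hx : x + 1 < N) :
    racahFwd q A B E (q ^ N) (q ^ x) / racahBwd q A B E (q ^ N) (q ^ (x + 1)) <
      racahFwd q A' B E (q ^ N) (q ^ x) / racahBwd q A' B E (q ^ N) (q ^ (x + 1)) := by
  obtain ⟨h0, -, -, h1, h2, h3, h4, h5, h6⟩ := h.ratio_eq hx
  obtain ⟨h0', -, -, h1', h2', -, -, -, -⟩ := h'.ratio_eq hx
  rw [h0, h0']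
  have key : (1 - A * q * q ^ x) / (A - E * q ^ x) < (1 - A' * q * q ^ x) / (A' - E * q ^ x) := by
    rw [div_lt_div_iff₀ h2 h2', ← sub_pos]
    have : (1 - A' * q * q ^ x) * (A - E * q ^ x) - (1 - A * q * q ^ x) * (A' - E * q ^ x) =
        (A - A') * (1 - E * q * (q ^ x) ^ 2) := by
      ring
    rw [this]
    exact mul_pos (sub_pos.2 hA) h6
  gcongr

lemma mul_mul_pow_lt_one (h : RacahParams q A B E) {k : ℕ} (hk : 2 ≤ k) : A * B * q ^ k < 1 := by
  obtain ⟨hq0, hq1, hE0, hE1, hEA, hAq, hB0, hBq⟩ := h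
  have hA0 : 0 < A := hE0.trans hEA
  calc A * B * q ^ k ≤ A * B * q ^ 2 := by
        gcongr ?_ * ?_
        exact pow_le_pow_of_le_one hq0.le hq1.le hk
    _ = (A * q) * (B * q) := by ring
    _ < 1 := by nlinarith [mul_pos hA0 hq0, mul_pos hB0 hq0]

lemma racahEigenvalue_sub (hq : q ≠ 0) (A B : ℝ) (n k : ℕ) :
    racahEigenvalue q A B n - racahEigenvalue q A B k =
      ((q ^ n)⁻¹ - (q ^ k)⁻¹) * (1 - A * B * q ^ (n + 1 + k)) := by
  simp only [racahEigenvalue, pow_succ, pow_add]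
  field_simp
  ring

lemma racahEigenvalue_ne (h : RacahParams q A B E) {k : ℕ} (hk : k < n) :
    racahEigenvalue q A B n - racahEigenvalue q A B k ≠ 0 := by
  rw [racahEigenvalue_sub h.q_pos.ne']
  refine mul_ne_zero (sub_ne_zero.2 fun he ↦ ?_) ?_
  · exact hk.ne' ((pow_right_strictAnti₀ h.q_pos h.q_lt_one).injective (inv_injective he))
  · have := h.mul_mul_pow_lt_one (k := n + 1 + k) (by omega)
    linarith

lemma factors_ne_zero (h : RacahParams q A B E) {j : ℕ} (hj : j + 1 < N) :
    B * E * q ^ N * q ^ j ≠ 1 ∧ A * q * q ^ j ≠ 1 ∧ q / q ^ N * q ^ j ≠ 1 ∧ q * q ^ j ≠ 1 := by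
  obtain ⟨-, h0, -, h1, -, h3, -⟩ := h.ratio_eq hj
  have hM : q ^ N ≠ 0 := (pow_pos h.q_pos N).ne'
  refine ⟨fun e ↦ by linarith, fun e ↦ by linarith, fun e ↦ ?_, fun e ↦ ?_⟩
  · have : q ^ (j + 1) = q ^ N := by
      rw [pow_succ]
      field_simp at e
      linarith
    exact hj.ne ((pow_right_strictAnti₀ h.q_pos h.q_lt_one).injective this)
  · rw [mul_comm (q ^ j), e] at h0
    simp at h0

lemma racahCoeff_denominators_ne_zero (h : RacahParams q A B E) {k : ℕ} (hk : k < N) :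
    qpoch q (B * E * q ^ N) k ≠ 0 ∧ qpoch q (A * q) k ≠ 0 ∧ qpoch q (q / q ^ N) k ≠ 0 ∧
      qpoch q q k ≠ 0 :=
  ⟨qpoch_ne_zero fun _ hj ↦ (h.factors_ne_zero (N := N) (by omega)).1,
    qpoch_ne_zero fun _ hj ↦ (h.factors_ne_zero (N := N) (by omega)).2.1,
    qpoch_ne_zero fun _ hj ↦ (h.factors_ne_zero (N := N) (by omega)).2.2.1,
    qpoch_ne_zero fun _ hj ↦ (h.factors_ne_zero (N := N) (by omega)).2.2.2⟩

lemma racahCoeff_self_ne_zero (h : RacahParams q A B E) (hn : 1 ≤ n) (hnN : n < N) :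
    racahCoeff q A B E (q ^ N) n n ≠ 0 := by
  obtain ⟨h1, h2, h3, h4⟩ := h.racahCoeff_denominators_ne_zero hnN
  refine div_ne_zero (mul_ne_zero (mul_ne_zero (qpoch_ne_zero fun j hj e ↦ ?_)
    (qpoch_ne_zero fun j hj e ↦ ?_)) (pow_ne_zero _ h.q_pos.ne'))
    (mul_ne_zero (mul_ne_zero (mul_ne_zero h1 h2) h3) h4)
  · have hq := pow_ne_zero n h.q_pos.ne'
    have : q ^ j = q ^ n := by
      field_simp at e
      exact e
    exact hj.ne ((pow_right_strictAnti₀ h.q_pos h.q_lt_one).injective this)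
  · have := h.mul_mul_pow_lt_one (k := n + 1 + j) (by omega)
    rw [mul_assoc, ← pow_add] at e
    linarith

lemma racahCoeff_succ (h : RacahParams q A B E) (hnN : n < N) {k : ℕ} (hk : k < n) :
    racahCoeff q A B E (q ^ N) n (k + 1) * (-(q ^ (k + 1))⁻¹ * (1 - A * q * q ^ k) *
        (1 - B * E * q ^ N * q ^ k) * (1 - q / q ^ N * q ^ k) * (1 - q * q ^ k)) =
      racahCoeff q A B E (q ^ N) n k * (racahEigenvalue q A B n - racahEigenvalue q A B k) := by
  obtain ⟨h1, h2, h3, h4⟩ := h.racahCoeff_denominators_ne_zero (k := k) (N := N) (by omega)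
  obtain ⟨f1, f2, f3, f4⟩ := h.factors_ne_zero (N := N) (j := k) (by omega)
  rw [racahEigenvalue_sub h.q_pos.ne', racahCoeff, racahCoeff]
  simp only [qpoch_succ]
  replace f1 := sub_ne_zero.2 f1.symm
  replace f2 := sub_ne_zero.2 f2.symm
  replace f3 := sub_ne_zero.2 f3.symm
  replace f4 := sub_ne_zero.2 f4.symm
  have hq := h.q_pos.ne'
  rw [show 1 - A * B * q ^ (n + 1 + k) = 1 - A * B * q ^ (n + 1) * q ^ k by rw [pow_add]; ring]
  generalize 1 - B * E * q ^ N * q ^ k = g1 at *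
  generalize 1 - A * q * q ^ k = g2 at *
  generalize 1 - q / q ^ N * q ^ k = g3 at *
  generalize 1 - q * q ^ k = g4 at *
  generalize qpoch q (B * E * q ^ N) k = g5 at *
  generalize qpoch q (A * q) k = g6 at *
  generalize qpoch q (q / q ^ N) k = g7 at *
  generalize qpoch q q k = g8 at *
  generalize 1 - A * B * q ^ (n + 1) * q ^ k = g9 at *
  generalize qpoch q (A * B * q ^ (n + 1)) k = g10 at *
  generalize qpoch q (q ^ n)⁻¹ k = g11 at *
  rw [pow_succ]
  field_simp
  ring

end RacahParams

/-- Summation by parts for a second-order difference operator. -/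
lemma sum_range_difference_operator_mul (w b d f g : ℕ → ℝ) (m : ℕ)
    (h : ∀ x < m, w x * b x = w (x + 1) * d (x + 1)) :
    ∑ x ∈ Finset.range (m + 1), w x * (b x * (f (x + 1) - f x) + d x * (f (x - 1) - f x)) * g x =
      w m * b m * (f (m + 1) - f m) * g m -
        ∑ x ∈ Finset.range m, w x * b x * (f (x + 1) - f x) * (g (x + 1) - g x) := by
  induction m with
  | zero =>
    simp only [zero_add, Finset.sum_range_one, Finset.sum_range_zero, Nat.zero_sub]
    ring
  | succ m ih =>
    rw [Finset.sum_range_succ, ih fun x hx ↦ h x (hx.trans m.lt_succ_self),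
      Finset.sum_range_succ _ m, Nat.add_sub_cancel]
    linear_combination ((f m - f (m + 1)) * g (m + 1)) * (-h m m.lt_succ_self)

open Polynomial in
/-- The `q`-Racah polynomial in terms of `e = q^a`, `A = q^β`, `B = q^α` and `M = q^N`. -/
noncomputable def racahPolynomial (q e A B M : ℝ) (n : ℕ) : ℝ[X] :=
  ∑ k ∈ Finset.range (n + 1), C (racahCoeff q A B (e ^ 2) M n k) * racahBasis q e k

open Polynomial in
lemma degree_racahPolynomial {q e A B M : ℝ} {n : ℕ} (hq : q ≠ 0) (he : e ≠ 0)
    (hc : racahCoeff q A B (e ^ 2) M n n ≠ 0) : (racahPolynomial q e A B M n).degree = n := by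
  have hn : (C (racahCoeff q A B (e ^ 2) M n n) * racahBasis q e n).degree = n := by
    rw [degree_C_mul hc, degree_racahBasis hq he]
  rw [racahPolynomial, Finset.sum_range_succ, degree_add_eq_right_of_degree_lt, hn]
  rw [hn]
  refine (degree_sum_le _ _).trans_lt ((Finset.sup_lt_iff (WithBot.bot_lt_coe n)).2 fun k hk ↦ ?_)
  rw [← smul_eq_C_mul]
  refine (degree_smul_le _ _).trans_lt ?_
  rw [degree_racahBasis hq he]
  exact WithBot.coe_lt_coe.2 (Finset.mem_range.1 hk)

namespace RacahParams

variable {q A B e : ℝ} {N n : ℕ}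

/-- The difference equation of the `q`-Racah polynomials. -/
lemma difference_equation (h : RacahParams q A B (e ^ 2)) (hnN : n < N) (x : ℕ) :
    let p : ℕ → ℝ := fun x ↦ ∑ k ∈ Finset.range (n + 1),
      racahCoeff q A B (e ^ 2) (q ^ N) n k * racahBasisVal q (e ^ 2) (q ^ x) k
    racahFwd q A B (e ^ 2) (q ^ N) (q ^ x) * (p (x + 1) - p x) +
      racahBwd q A B (e ^ 2) (q ^ N) (q ^ x) * (p (x - 1) - p x) =
      racahEigenvalue q A B n * p x := by
  intro p
  have hM : q ^ N ≠ 0 := (pow_pos h.q_pos N).ne'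
  have hL : racahFwd q A B (e ^ 2) (q ^ N) (q ^ x) * (p (x + 1) - p x) +
      racahBwd q A B (e ^ 2) (q ^ N) (q ^ x) * (p (x - 1) - p x) =
      ∑ k ∈ Finset.range (n + 1), racahCoeff q A B (e ^ 2) (q ^ N) n k *
        (racahFwd q A B (e ^ 2) (q ^ N) (q ^ x) * (racahBasisVal q (e ^ 2) (q ^ (x + 1)) k -
          racahBasisVal q (e ^ 2) (q ^ x) k) +
        racahBwd q A B (e ^ 2) (q ^ N) (q ^ x) * (racahBasisVal q (e ^ 2) (q ^ (x - 1)) k -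
          racahBasisVal q (e ^ 2) (q ^ x) k)) := by
    simp only [p, ← Finset.sum_sub_distrib, Finset.mul_sum, ← Finset.sum_add_distrib]
    exact Finset.sum_congr rfl fun k _ ↦ by ring
  have hstep : ∀ k ∈ Finset.range n, racahCoeff q A B (e ^ 2) (q ^ N) n (k + 1) *
        (racahFwd q A B (e ^ 2) (q ^ N) (q ^ x) * (racahBasisVal q (e ^ 2) (q ^ (x + 1)) (k + 1) -
          racahBasisVal q (e ^ 2) (q ^ x) (k + 1)) +
        racahBwd q A B (e ^ 2) (q ^ N) (q ^ x) * (racahBasisVal q (e ^ 2) (q ^ (x - 1)) (k + 1) -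
          racahBasisVal q (e ^ 2) (q ^ x) (k + 1))) =
      racahEigenvalue q A B n *
        (racahCoeff q A B (e ^ 2) (q ^ N) n k * racahBasisVal q (e ^ 2) (q ^ x) k) +
      (racahEigenvalue q A B (k + 1) *
        (racahCoeff q A B (e ^ 2) (q ^ N) n (k + 1) * racahBasisVal q (e ^ 2) (q ^ x) (k + 1)) -
      racahEigenvalue q A B k *
        (racahCoeff q A B (e ^ 2) (q ^ N) n k * racahBasisVal q (e ^ 2) (q ^ x) k)) := by
    intro k hk
    rw [racah_triangular h.q_pos h.q_lt_one h.E_pos h.E_lt_one hM]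
    linear_combination racahBasisVal q (e ^ 2) (q ^ x) k *
      h.racahCoeff_succ hnN (Finset.mem_range.1 hk)
  rw [hL, Finset.sum_range_succ', Finset.sum_congr rfl hstep, Finset.sum_add_distrib,
    Finset.sum_range_sub (fun k ↦ racahEigenvalue q A B k *
      (racahCoeff q A B (e ^ 2) (q ^ N) n k * racahBasisVal q (e ^ 2) (q ^ x) k)),
    ← Finset.mul_sum]
  simp only [p, Finset.sum_range_succ _ n]
  simp [racahBasisVal, racahEigenvalue]
  ring

lemma racahFwd_last (h : RacahParams q A B (e ^ 2)) (m : ℕ) :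
    racahFwd q A B (e ^ 2) (q ^ (m + 1)) (q ^ m) = 0 := by
  have : q ^ m * q / q ^ (m + 1) = 1 := by
    rw [← pow_succ]; exact div_self (pow_ne_zero _ h.q_pos.ne')
  simp [racahFwd, this]

/-- The difference operator is symmetric with respect to the weight. -/
lemma symmetric (h : RacahParams q A B (e ^ 2)) (f g : ℕ → ℝ) :
    ∑ x ∈ Finset.range N, racahWeight q A B (e ^ 2) (q ^ N) x *
      (racahFwd q A B (e ^ 2) (q ^ N) (q ^ x) * (f (x + 1) - f x) +
        racahBwd q A B (e ^ 2) (q ^ N) (q ^ x) * (f (x - 1) - f x)) * g x =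
    ∑ x ∈ Finset.range N, racahWeight q A B (e ^ 2) (q ^ N) x *
      (racahFwd q A B (e ^ 2) (q ^ N) (q ^ x) * (g (x + 1) - g x) +
        racahBwd q A B (e ^ 2) (q ^ N) (q ^ x) * (g (x - 1) - g x)) * f x := by
  rcases N with _ | m
  · simp
  have hbal : ∀ x < m, _ := fun x hx ↦
    h.racahWeight_balance (N := m + 1) (Nat.add_lt_add_right hx 1)
  have key := fun f g : ℕ → ℝ ↦ sum_range_difference_operator_mul
    (racahWeight q A B (e ^ 2) (q ^ (m + 1)))
    (fun x ↦ racahFwd q A B (e ^ 2) (q ^ (m + 1)) (q ^ x))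
    (fun x ↦ racahBwd q A B (e ^ 2) (q ^ (m + 1)) (q ^ x)) f g m hbal
  simp only [h.racahFwd_last, mul_zero, zero_mul, zero_sub] at key
  rw [key, key]
  congr 1
  exact Finset.sum_congr rfl fun x _ ↦ by ring

lemma sum_mul_racahBasisVal (h : RacahParams q A B (e ^ 2)) (hnN : n < N) (k : ℕ) (hk : k < n) :
    ∑ x ∈ Finset.range N, racahWeight q A B (e ^ 2) (q ^ N) x *
      (∑ i ∈ Finset.range (n + 1),
        racahCoeff q A B (e ^ 2) (q ^ N) n i * racahBasisVal q (e ^ 2) (q ^ x) i) *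
      racahBasisVal q (e ^ 2) (q ^ x) k = 0 := by
  have hM : q ^ N ≠ 0 := (pow_pos h.q_pos N).ne'
  set p : ℕ → ℝ := fun x ↦ ∑ i ∈ Finset.range (n + 1),
    racahCoeff q A B (e ^ 2) (q ^ N) n i * racahBasisVal q (e ^ 2) (q ^ x) i with hp
  have hsym := fun k ↦ h.symmetric (N := N) p fun x ↦ racahBasisVal q (e ^ 2) (q ^ x) k
  have hd := h.difference_equation hnN
  change ∀ x, racahFwd q A B (e ^ 2) (q ^ N) (q ^ x) * (p (x + 1) - p x) +
      racahBwd q A B (e ^ 2) (q ^ N) (q ^ x) * (p (x - 1) - p x) =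
      racahEigenvalue q A B n * p x at hd
  have hpull : ∀ k, racahEigenvalue q A B n * ∑ x ∈ Finset.range N,
      racahWeight q A B (e ^ 2) (q ^ N) x * p x * racahBasisVal q (e ^ 2) (q ^ x) k =
      ∑ x ∈ Finset.range N, racahWeight q A B (e ^ 2) (q ^ N) x *
        (racahEigenvalue q A B n * p x) * racahBasisVal q (e ^ 2) (q ^ x) k := fun k ↦ by
    rw [Finset.mul_sum]
    exact Finset.sum_congr rfl fun x _ ↦ by ring
  have hne := h.racahEigenvalue_ne hk
  simp only [hd] at hsym
  induction k with
  | zero =>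
    have h1 := (hpull 0).trans (hsym 0)
    have h0 : racahEigenvalue q A B 0 = 0 := by simp [racahEigenvalue]
    rw [h0, sub_zero] at hne
    have hφ : ∀ u, racahBasisVal q (e ^ 2) u 0 = 1 := fun u ↦ by simp [racahBasisVal]
    refine (mul_eq_zero.1 ?_).resolve_left hne
    rw [h1]
    simp [hφ]
  | succ k ih =>
    have h0 := ih (by omega) (h.racahEigenvalue_ne (by omega))
    have h1 := (hpull (k + 1)).trans (hsym (k + 1))
    simp only [racah_triangular h.q_pos h.q_lt_one h.E_pos h.E_lt_one hM] at h1
    refine (mul_eq_zero.1 ?_).resolve_left hne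
    have h2 : ∑ x ∈ Finset.range N, racahWeight q A B (e ^ 2) (q ^ N) x *
        (racahEigenvalue q A B (k + 1) * racahBasisVal q (e ^ 2) (q ^ x) (k + 1) +
      -(q ^ (k + 1))⁻¹ * (1 - A * q * q ^ k) * (1 - B * e ^ 2 * q ^ N * q ^ k) *
        (1 - q / q ^ N * q ^ k) * (1 - q * q ^ k) * racahBasisVal q (e ^ 2) (q ^ x) k) * p x =
        racahEigenvalue q A B (k + 1) * ∑ x ∈ Finset.range N,
          racahWeight q A B (e ^ 2) (q ^ N) x * p x * racahBasisVal q (e ^ 2) (q ^ x) (k + 1) +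
        -(q ^ (k + 1))⁻¹ * (1 - A * q * q ^ k) * (1 - B * e ^ 2 * q ^ N * q ^ k) *
          (1 - q / q ^ N * q ^ k) * (1 - q * q ^ k) * ∑ x ∈ Finset.range N,
          racahWeight q A B (e ^ 2) (q ^ N) x * p x * racahBasisVal q (e ^ 2) (q ^ x) k := by
      rw [Finset.mul_sum, Finset.mul_sum, ← Finset.sum_add_distrib]
      exact Finset.sum_congr rfl fun x _ ↦ by ring
    rw [h2, h0] at h1
    linear_combination h1

open Polynomial in
/-- Orthogonality of the `q`-Racah polynomials. -/
lemma discreteOrthogonal (h : RacahParams q A B (e ^ 2)) (he : e ≠ 0) (hnN : n < N) :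
    DiscreteOrthogonal (racahGrid q e) (racahWeight q A B (e ^ 2) (q ^ N)) N n
      (racahPolynomial q e A B (q ^ N) n) := by
  have hq := h.q_pos.ne'
  have hev : ∀ x, (racahPolynomial q e A B (q ^ N) n).eval (racahGrid q e x) =
      ∑ i ∈ Finset.range (n + 1),
        racahCoeff q A B (e ^ 2) (q ^ N) n i * racahBasisVal q (e ^ 2) (q ^ x) i := fun x ↦ by
    simp [racahPolynomial, eval_finsetSum, eval_racahBasis hq he]
  suffices H : ∀ d ≤ n, ∀ f : ℝ[X], f.degree < d → ∑ x ∈ Finset.range N,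
      racahWeight q A B (e ^ 2) (q ^ N) x *
        (racahPolynomial q e A B (q ^ N) n * f).eval (racahGrid q e x) = 0 from H n le_rfl
  intro d
  induction d with
  | zero =>
    intro _ f hf
    have : f = 0 := by simpa using hf
    simp [this]
  | succ d ih =>
    intro hd f hf
    have hφ := degree_racahBasis (q := q) (e := e) hq he d
    have hlead : (racahBasis q e d).coeff d ≠ 0 := coeff_ne_zero_of_eq_degree hφ
    set c := f.coeff d / (racahBasis q e d).coeff d with hc
    have hlt : (f - C c * racahBasis q e d).degree < d := by
      rw [degree_lt_iff_coeff_zero]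
      intro m hm
      rcases hm.eq_or_lt with rfl | hm
      · simp [hc, hlead]
      · rw [coeff_sub, coeff_C_mul, coeff_eq_zero_of_degree_lt (hf.trans_le (Nat.cast_le.2 hm)),
          coeff_eq_zero_of_degree_lt (hφ.trans_lt (Nat.cast_lt.2 hm))]
        simp
    have h1 := ih (by omega) _ hlt
    have h2 := h.sum_mul_racahBasisVal hnN d (by omega)
    have h3 : ∑ x ∈ Finset.range N, racahWeight q A B (e ^ 2) (q ^ N) x *
        (racahPolynomial q e A B (q ^ N) n * f).eval (racahGrid q e x) =
        ∑ x ∈ Finset.range N, racahWeight q A B (e ^ 2) (q ^ N) x *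
          (racahPolynomial q e A B (q ^ N) n * (f - C c * racahBasis q e d)).eval
            (racahGrid q e x) +
        c * ∑ x ∈ Finset.range N, racahWeight q A B (e ^ 2) (q ^ N) x *
          (∑ i ∈ Finset.range (n + 1),
            racahCoeff q A B (e ^ 2) (q ^ N) n i * racahBasisVal q (e ^ 2) (q ^ x) i) *
          racahBasisVal q (e ^ 2) (q ^ x) d := by
      rw [Finset.mul_sum, ← Finset.sum_add_distrib]
      refine Finset.sum_congr rfl fun x _ ↦ ?_
      simp only [eval_mul, eval_sub, eval_C, hev, eval_racahBasis hq he]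
      ring
    rw [h3, h1, h2, mul_zero, add_zero]

end RacahParams

lemma racahParams_rpow {q a α β : ℝ} (hq0 : 0 < q) (hq1 : q < 1) (ha : 0 < a) (hα : -1 < α)
    (hβ : -1 < β) (hβa : β < 2 * a) : RacahParams q (q ^ β) (q ^ α) ((q ^ a) ^ 2) := by
  have hsq : (q ^ a) ^ 2 = q ^ (2 * a) := by
    rw [← Real.rpow_natCast, ← Real.rpow_mul hq0.le, mul_comm a]
    norm_cast
  have hmul : ∀ t : ℝ, -1 < t → q ^ t * q < 1 := fun t ht ↦ by
    rw [← Real.rpow_add_one hq0.ne']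
    exact Real.rpow_lt_one hq0.le hq1 (by linarith)
  refine ⟨hq0, hq1, by positivity, ?_, ?_, hmul β hβ, by positivity, hmul α hα⟩
  · rw [hsq]
    exact Real.rpow_lt_one hq0.le hq1 (by linarith)
  · rw [hsq]
    exact Real.rpow_lt_rpow_of_exponent_gt hq0 hq1 hβa

lemma qRacahPoly_eq_eval {q : ℝ} (hq0 : 0 < q) (a : ℝ) (N n : ℕ) (α β y : ℝ) :
    qRacahPoly q a N n α β y =
      (racahPolynomial q (q ^ a) (q ^ β) (q ^ α) (q ^ N) n).eval y := by
  have h1 : q ^ (α + β + (n : ℝ) + 1) = q ^ β * q ^ α * q ^ (n + 1) := by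
    rw [Real.rpow_add_one hq0.ne', Real.rpow_add hq0, Real.rpow_add hq0, Real.rpow_natCast]
    ring
  have hpow : ∀ t : ℝ, q ^ (2 * t) = (q ^ t) ^ 2 := fun t ↦ by
    rw [← Real.rpow_natCast, ← Real.rpow_mul hq0.le, mul_comm t]
    norm_cast
  have h2 : q ^ (2 * a + α + (N : ℝ)) = q ^ α * (q ^ a) ^ 2 * q ^ N := by
    rw [Real.rpow_add hq0, Real.rpow_add hq0, Real.rpow_natCast, hpow]
    ring
  have h3 : q ^ ((1 : ℝ) - (N : ℝ)) = q / q ^ N := by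
    rw [Real.rpow_sub hq0, Real.rpow_one, Real.rpow_natCast]
  have h4 : q ^ (β + 1) = q ^ β * q := Real.rpow_add_one hq0.ne' β
  have h5 : q ^ (-(n : ℤ)) = (q ^ n)⁻¹ := by simp
  have h6 : ∀ j : ℕ, q ^ (a + (j : ℝ)) = q ^ a * q ^ j := fun j ↦ by
    rw [Real.rpow_add hq0, Real.rpow_natCast]
  rw [qRacahPoly, racahPolynomial, Polynomial.eval_finsetSum]
  refine Finset.sum_congr rfl fun k _ ↦ ?_
  have hb : (racahBasis q (q ^ a) k).eval y = ∏ j ∈ Finset.range k,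
      (1 - 2 * q ^ (a + (j : ℝ)) * y + q ^ (2 * (a + (j : ℝ)))) := by
    rw [racahBasis, Polynomial.eval_prod]
    refine Finset.prod_congr rfl fun j _ ↦ ?_
    simp only [Polynomial.eval_add, Polynomial.eval_mul, Polynomial.eval_C, Polynomial.eval_X,
      hpow, h6]
    ring
  rw [Polynomial.eval_mul, Polynomial.eval_C, hb, racahCoeff, h1, h2, h3, h4, h5]
  ring

/-- zeros of q-Racah polynomials: monotonicity in `α` and `β`. -/
theorem stmt_18 (q : ℝ) (hq0 : 0 < q) (hq1 : q < 1) (a : ℝ) (ha : 0 < a)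
    (N n : ℕ) (hN : 2 ≤ N) (hn : 1 ≤ n) (hnN : n ≤ N - 1) :
    ∃ X : ℝ → ℝ → Fin n → ℝ,
      (∀ α β : ℝ, -1 < α → -1 < β → β < 2 * a →
        StrictMono (X α β) ∧
        (∀ j, qRacahPoly q a N n α β (X α β j) = 0) ∧
        (∀ y : ℝ, qRacahPoly q a N n α β y = 0 → ∃ j, y = X α β j)) ∧
      (1 / 2 ≤ a →
        (∀ β : ℝ, -1 < β → β < 2 * a →
          ∀ j, StrictAntiOn (fun α => X α β j) (Set.Ioi (-1))) ∧
        (∀ α : ℝ, -1 < α →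
          ∀ j, StrictMonoOn (fun β => X α β j) (Set.Ioo (-1) (2 * a)))) ∧
      (a < 1 / 2 →
        (∀ β : ℝ, a - 1 / 2 < β → β < 2 * a →
          ∀ j, StrictAntiOn (fun α => X α β j) (Set.Ioi (-1))) ∧
        (∀ α : ℝ, -1 < α →
          ∀ j, StrictMonoOn (fun β => X α β j) (Set.Ioo (a - 1 / 2) (2 * a)))) := by
  have hnN' : n < N := by omega
  set e := q ^ a with he
  have he0 : 0 < e := Real.rpow_pos_of_pos hq0 a
  have hgrid : StrictMono (racahGrid q e) :=
    strictMono_racahGrid hq0 hq1 he0 (Real.rpow_lt_one hq0.le hq1 ha)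
  set P : ℝ → ℝ → Polynomial ℝ := fun α β ↦ racahPolynomial q e (q ^ β) (q ^ α) (q ^ N) n with hP
  have hpar : ∀ α β : ℝ, -1 < α → -1 < β → β < 2 * a → RacahParams q (q ^ β) (q ^ α) (e ^ 2) :=
    fun α β hα hβ hβa ↦ racahParams_rpow hq0 hq1 ha hα hβ hβa
  have hdeg : ∀ α β : ℝ, -1 < α → -1 < β → β < 2 * a → (P α β).degree = n :=
    fun α β hα hβ hβa ↦ degree_racahPolynomial hq0.ne' he0.ne'
      ((hpar α β hα hβ hβa).racahCoeff_self_ne_zero hn hnN')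
  have hnat : ∀ α β : ℝ, -1 < α → -1 < β → β < 2 * a → (P α β).natDegree = n :=
    fun α β hα hβ hβa ↦ Polynomial.natDegree_eq_of_degree_eq_some (hdeg α β hα hβ hβa)
  have hne : ∀ α β : ℝ, -1 < α → -1 < β → β < 2 * a → P α β ≠ 0 := fun α β hα hβ hβa h0 ↦ by
    simpa [h0] using hdeg α β hα hβ hβa
  have horth : ∀ α β : ℝ, -1 < α → -1 < β → β < 2 * a → DiscreteOrthogonal (racahGrid q e)
      (racahWeight q (q ^ β) (q ^ α) (e ^ 2) (q ^ N)) N n (P α β) :=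
    fun α β hα hβ hβa ↦ (hpar α β hα hβ hβa).discreteOrthogonal he0.ne' hnN'
  have hex : ∀ α β : ℝ, ∃ z : Fin n → ℝ, -1 < α → -1 < β → β < 2 * a → StrictMono z ∧
      (∀ j, (P α β).eval (z j) = 0) ∧ ∀ y, (P α β).eval y = 0 → ∃ j, y = z j := by
    intro α β
    by_cases h : -1 < α ∧ -1 < β ∧ β < 2 * a
    · obtain ⟨hα, hβ, hβa⟩ := h
      obtain ⟨z, hz⟩ := (horth α β hα hβ hβa).exists_strictMono_zeros hgrid.injective.injOn
        (fun x hx ↦ (hpar α β hα hβ hβa).racahWeight_pos hx) (hnat α β hα hβ hβa)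
        (hne α β hα hβ hβa) hnN'
      exact ⟨z, fun _ _ _ ↦ hz⟩
    · exact ⟨0, fun h1 h2 h3 ↦ absurd ⟨h1, h2, h3⟩ h⟩
  choose X hX using hex
  have hanti : ∀ β : ℝ, -1 < β → β < 2 * a →
      ∀ j, StrictAntiOn (fun α => X α β j) (Set.Ioi (-1)) := by
    intro β hβ hβa j α hα α' hα' hlt
    have h := hpar α β hα hβ hβa
    have h' := hpar α' β hα' hβ hβa
    have hB := Real.rpow_lt_rpow_of_exponent_gt hq0 hq1 hlt
    obtain ⟨hz, hr, -⟩ := hX α β hα hβ hβa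
    obtain ⟨hz', hr', -⟩ := hX α' β hα' hβ hβa
    exact (horth α' β hα' hβ hβa).zeros_lt_zeros (horth α β hα hβ hβa) hgrid hnN'
      (fun x hx ↦ h'.racahWeight_pos hx) (fun x hx ↦ h.racahWeight_pos hx)
      (h'.racahWeight_cross h fun x hx ↦ h'.ratio_lt_of_B_lt h hB hx)
      (hnat _ _ hα' hβ hβa) (hnat _ _ hα hβ hβa) (hne _ _ hα' hβ hβa) (hne _ _ hα hβ hβa)
      hz' hz hr' hr j
  have hmono : ∀ α : ℝ, -1 < α →
      ∀ j, StrictMonoOn (fun β => X α β j) (Set.Ioo (-1) (2 * a)) := by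
    intro α hα j β hβ β' hβ' hlt
    have h := hpar α β hα hβ.1 hβ.2
    have h' := hpar α β' hα hβ'.1 hβ'.2
    have hA := Real.rpow_lt_rpow_of_exponent_gt hq0 hq1 hlt
    obtain ⟨hz, hr, -⟩ := hX α β hα hβ.1 hβ.2
    obtain ⟨hz', hr', -⟩ := hX α β' hα hβ'.1 hβ'.2
    exact (horth α β hα hβ.1 hβ.2).zeros_lt_zeros (horth α β' hα hβ'.1 hβ'.2) hgrid hnN'
      (fun x hx ↦ h.racahWeight_pos hx) (fun x hx ↦ h'.racahWeight_pos hx)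
      (h.racahWeight_cross h' fun x hx ↦ h.ratio_lt_of_A_lt h' hA hx)
      (hnat _ _ hα hβ.1 hβ.2) (hnat _ _ hα hβ'.1 hβ'.2) (hne _ _ hα hβ.1 hβ.2)
      (hne _ _ hα hβ'.1 hβ'.2) hz hz' hr hr' j
  refine ⟨X, fun α β hα hβ hβa ↦ ?_, fun _ ↦ ⟨hanti, hmono⟩, fun _ ↦
    ⟨fun β hβ ↦ hanti β (by linarith), fun α hα j ↦ (hmono α hα j).mono
      (Set.Ioo_subset_Ioo_left (by linarith))⟩⟩
  simp only [qRacahPoly_eq_eval hq0]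
  exact hX α β hα hβ hβa
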